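/- arXiv:2202.06714 — 2 statements merged into one kernel-verified Lean document; each statement's English description precedes it below -/
import Mathlib

section
/- Let δ₀ ∈ (0, π), M > 0, a > 0 and 0 < c₁ ≤ C₁. Let ρ be a probability density on [−π,π] with ρ(x) = ρ(−x), supported in [−Θ,Θ] for some 0 < Θ ≤ π − δ₀, with ρ ≤ M almost everywhere and c₁√x ≤ ρ(Θ−x) ≤ C₁√x for 0 < x < a. Then there exist constants c, C > 0, depending only on δ₀, M, a, c₁, C₁, such that for every η ∈ (0, 5] and every κ ∈ (0, π − Θ), the point z = (1+η)·e^{i(Θ+κ)} satisfies c·η/√(κ+η) ≤ −Re f_ρ(z) ≤ C·η/√(κ+η). -/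
open MeasureTheory

noncomputable section

/-- The Cauchy transform of an integrable density `ρ` on `[−π, π]`:
`f_ρ(z) = ∫_{−π}^{π} (e^{iθ} + z)/(e^{iθ} − z)·ρ(θ) dθ`. -/
def cauchyTransformD (ρ : ℝ → ℝ) (z : ℂ) : ℂ :=
  ∫ θ in (-Real.pi)..Real.pi,
    ((Complex.exp ((θ : ℂ) * Complex.I) + z) / (Complex.exp ((θ : ℂ) * Complex.I) - z)) *
      (ρ θ : ℂ)

/-- `ρ` is a symmetric probability density on `[−π, π]` supported in `[−Θ, Θ]`, bounded
a.e. by `M`, with square-root behavior `c₁√x ≤ ρ(Θ−x) ≤ C₁√x` for `0 < x < a`. -/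
def IsEdgeDensity (Θ M a c₁ C₁ : ℝ) (ρ : ℝ → ℝ) : Prop :=
  (∀ x, 0 ≤ ρ x) ∧ (∫ x in (-Real.pi)..Real.pi, ρ x) = 1 ∧ (∀ x, ρ x = ρ (-x)) ∧
    (∀ x, Θ < |x| → ρ x = 0) ∧ (∀ᵐ x ∂(volume : Measure ℝ), ρ x ≤ M) ∧
    (∀ x, 0 < x → x < a →
      c₁ * Real.sqrt x ≤ ρ (Θ - x) ∧ ρ (Θ - x) ≤ C₁ * Real.sqrt x)

/-- The real part of the kernel of the Cauchy transform is minus the exterior Poisson kernel. -/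
lemma neg_re_kernel (η φ θ : ℝ) :
    -((Complex.exp ((θ : ℂ) * Complex.I) +
          ((1 + η : ℝ) : ℂ) * Complex.exp ((φ : ℂ) * Complex.I)) /
        (Complex.exp ((θ : ℂ) * Complex.I) -
          ((1 + η : ℝ) : ℂ) * Complex.exp ((φ : ℂ) * Complex.I))).re =
      η * (2 + η) / (η ^ 2 + 4 * (1 + η) * Real.sin ((φ - θ) / 2) ^ 2) := by
  have hD : η ^ 2 + 4 * (1 + η) * Real.sin ((φ - θ) / 2) ^ 2 =
      Complex.normSq (Complex.exp ((θ : ℂ) * Complex.I) -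
          ((1 + η : ℝ) : ℂ) * Complex.exp ((φ : ℂ) * Complex.I)) := by
    have h1 : Real.sin ((φ - θ) / 2) ^ 2 = 1 / 2 - Real.cos (φ - θ) / 2 := by
      rw [Real.sin_sq_eq_half_sub]; ring_nf
    rw [h1, Real.cos_sub, Complex.normSq_apply]
    simp only [Complex.sub_re, Complex.sub_im, Complex.re_ofReal_mul, Complex.im_ofReal_mul,
      Complex.exp_ofReal_mul_I_re, Complex.exp_ofReal_mul_I_im]
    linear_combination (-1) * Real.sin_sq_add_cos_sq θ -
      (1 + η) ^ 2 * Real.sin_sq_add_cos_sq φ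
  rw [Complex.div_re, hD, ← add_div, ← neg_div]
  congr 1
  simp only [Complex.sub_re, Complex.sub_im, Complex.add_re, Complex.add_im,
    Complex.re_ofReal_mul, Complex.im_ofReal_mul,
    Complex.exp_ofReal_mul_I_re, Complex.exp_ofReal_mul_I_im]
  linear_combination (-1) * Real.sin_sq_add_cos_sq θ +
      (1 + η) ^ 2 * Real.sin_sq_add_cos_sq φ

lemma poissonDenom_pos (η x : ℝ) (hη : 0 < η) :
    0 < η ^ 2 + 4 * (1 + η) * Real.sin x ^ 2 := by positivity

lemma continuous_poissonKernel (η φ : ℝ) (hη : 0 < η) : Continuous fun θ : ℝ =>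
    η * (2 + η) / (η ^ 2 + 4 * (1 + η) * Real.sin ((φ - θ) / 2) ^ 2) :=
  Continuous.div (by fun_prop) (by fun_prop) fun θ => (poissonDenom_pos η _ hη).ne'

/-- Poisson representation of the real part of the Cauchy transform outside the unit disc. -/
lemma neg_re_cauchyTransformD (ρ : ℝ → ℝ)
    (hρ : IntervalIntegrable ρ volume (-Real.pi) Real.pi) (η φ : ℝ) (hη : 0 < η) :
    -(cauchyTransformD ρ (((1 + η : ℝ) : ℂ) * Complex.exp ((φ : ℂ) * Complex.I))).re =
      ∫ θ in (-Real.pi)..Real.pi,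
        η * (2 + η) / (η ^ 2 + 4 * (1 + η) * Real.sin ((φ - θ) / 2) ^ 2) * ρ θ := by
  have hne : ∀ θ : ℝ, Complex.exp ((θ : ℂ) * Complex.I) -
      ((1 + η : ℝ) : ℂ) * Complex.exp ((φ : ℂ) * Complex.I) ≠ 0 := by
    intro θ h
    have h2 := congrArg norm (sub_eq_zero.mp h)
    rw [norm_mul, Complex.norm_exp_ofReal_mul_I, Complex.norm_exp_ofReal_mul_I,
      Complex.norm_real, Real.norm_of_nonneg (by linarith)] at h2
    linarith
  have hint : IntervalIntegrable (fun θ : ℝ =>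
      ((Complex.exp ((θ : ℂ) * Complex.I) +
          ((1 + η : ℝ) : ℂ) * Complex.exp ((φ : ℂ) * Complex.I)) /
        (Complex.exp ((θ : ℂ) * Complex.I) -
          ((1 + η : ℝ) : ℂ) * Complex.exp ((φ : ℂ) * Complex.I))) * (ρ θ : ℂ))
      volume (-Real.pi) Real.pi := by
    refine IntervalIntegrable.continuousOn_mul (f := fun θ => (ρ θ : ℂ)) ?_ ?_
    · exact ⟨hρ.1.ofReal, hρ.2.ofReal⟩
    · exact (Continuous.div (by fun_prop) (by fun_prop) hne).continuousOn
  have h := Complex.reCLM.intervalIntegral_comp_comm hint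
  simp only [Complex.reCLM_apply] at h
  rw [cauchyTransformD, ← h, ← intervalIntegral.integral_neg]
  refine intervalIntegral.integral_congr fun θ _ => ?_
  simp only [Complex.re_mul_ofReal]
  rw [← neg_mul, neg_re_kernel η φ θ]

/-- A linear lower bound for the sine away from `π`. -/
lemma mul_le_sin_of_le_pi_sub {δ u : ℝ} (hδ : 0 < δ) (hδ' : δ < Real.pi) (hu : 0 ≤ u)
    (hu' : u ≤ Real.pi - δ / 2) : δ / Real.pi ^ 2 * u ≤ Real.sin u := by
  have hpi := Real.pi_pos
  rcases le_total u (Real.pi / 2) with h | h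
  · refine le_trans ?_ (Real.mul_le_sin hu h)
    refine mul_le_mul_of_nonneg_right ?_ hu
    rw [div_le_div_iff₀ (by positivity) hpi]
    nlinarith
  · rw [← Real.sin_pi_sub]
    refine le_trans ?_ (Real.mul_le_sin (by linarith) (by linarith))
    rw [div_mul_eq_mul_div, div_mul_eq_mul_div, div_le_div_iff₀ (by positivity) hpi]
    have : δ * u ≤ 2 * (Real.pi - u) * Real.pi :=
      mul_le_mul (by linarith) (by linarith) hu (by linarith)
    nlinarith

lemma hasDerivAt_two_div_sqrt_sub {A x : ℝ} (h : x < A) :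
    HasDerivAt (fun x => 2 / Real.sqrt (A - x)) (1 / ((A - x) * Real.sqrt (A - x))) x := by
  have h0 : 0 < A - x := by linarith
  have hs := Real.sqrt_pos.mpr h0
  have h1 : HasDerivAt (fun x => A - x) (-1) x := by
    simpa using (hasDerivAt_id x).const_sub A
  have h2 := (hasDerivAt_const x (2 : ℝ)).div (h1.sqrt h0.ne') hs.ne'
  refine HasDerivAt.congr_deriv h2 ?_
  rw [Real.sq_sqrt h0.le]
  field_simp
  ring

lemma intervalIntegrable_one_div_mul_sqrt_sub {A b c : ℝ} (hbc : b ≤ c) (hc : c < A) :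
    IntervalIntegrable (fun x => 1 / ((A - x) * Real.sqrt (A - x))) volume b c := by
  refine ContinuousOn.intervalIntegrable (ContinuousOn.div (by fun_prop) (by fun_prop) ?_)
  intro x hx
  rw [Set.uIcc_of_le hbc] at hx
  have h0 : 0 < A - x := by linarith [hx.2]
  have := Real.sqrt_pos.mpr h0
  positivity

lemma integral_one_div_mul_sqrt_sub_le {A b c : ℝ} (hbc : b ≤ c) (hc : c < A) :
    (∫ x in b..c, 1 / ((A - x) * Real.sqrt (A - x))) ≤ 2 / Real.sqrt (A - c) := by
  have hlt : ∀ x ∈ Set.uIcc b c, x < A := fun x hx => by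
    rw [Set.uIcc_of_le hbc] at hx; linarith [hx.2]
  rw [intervalIntegral.integral_eq_sub_of_hasDerivAt
    (fun x hx => hasDerivAt_two_div_sqrt_sub (hlt x hx))]
  · have : 0 ≤ 2 / Real.sqrt (A - b) := by positivity
    linarith
  · exact intervalIntegrable_one_div_mul_sqrt_sub hbc hc

/-- Upper bound for the Poisson kernel at distance `v` from the singularity. -/
lemma poissonKernel_le {δ η v : ℝ} (hδ : 0 < δ) (hδ' : δ < Real.pi) (hη : 0 < η) (hη' : η ≤ 5)
    (hv : 0 < v) (hv' : v ≤ 2 * Real.pi - δ) :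
    η * (2 + η) / (η ^ 2 + 4 * (1 + η) * Real.sin (v / 2) ^ 2) ≤
      14 / (δ / Real.pi ^ 2) ^ 2 * η / (η + v) ^ 2 := by
  have hk : 0 < δ / Real.pi ^ 2 := by positivity
  have hk1 : δ / Real.pi ^ 2 ≤ 1 := by
    rw [div_le_one (by positivity)]
    nlinarith [Real.pi_gt_three]
  have hs := mul_le_sin_of_le_pi_sub hδ hδ' (u := v / 2) (by linarith) (by linarith)
  generalize δ / Real.pi ^ 2 = k at *
  generalize Real.sin (v / 2) = S at *
  have h1 : (k * (v / 2)) ^ 2 ≤ S ^ 2 := by gcongr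
  have h2 : k ^ 2 ≤ 1 := by nlinarith
  have h3 : k ^ 2 * (η + v) ^ 2 ≤ 2 * (η ^ 2 + 4 * (1 + η) * S ^ 2) := by
    have e1 : k ^ 2 * (η + v) ^ 2 ≤ k ^ 2 * (2 * η ^ 2 + 2 * v ^ 2) := by
      gcongr; nlinarith [sq_nonneg (η - v)]
    have e2 : k ^ 2 * η ^ 2 ≤ 1 * η ^ 2 := by gcongr
    have e3 : 0 ≤ η * S ^ 2 := by positivity
    nlinarith
  rw [div_mul_eq_mul_div, div_div, div_le_div_iff₀ (by positivity) (by positivity)]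
  have h4 : η * (2 + η) ≤ 7 * η := by nlinarith
  calc η * (2 + η) * (k ^ 2 * (η + v) ^ 2)
      ≤ 7 * η * (2 * (η ^ 2 + 4 * (1 + η) * S ^ 2)) := by gcongr
    _ = _ := by ring

/-- Lower bound for the Poisson kernel at distance `v` from the singularity. -/
lemma le_poissonKernel {η v : ℝ} (hη : 0 < η) (hη' : η ≤ 5) (hv : 0 < v) :
    1 / 3 * η / (η + v) ^ 2 ≤
      η * (2 + η) / (η ^ 2 + 4 * (1 + η) * Real.sin (v / 2) ^ 2) := by
  have hs : Real.sin (v / 2) ^ 2 ≤ (v / 2) ^ 2 :=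
    sq_le_sq.mpr ((Real.abs_sin_le_abs).trans_eq rfl)
  generalize Real.sin (v / 2) = S at *
  rw [div_le_div_iff₀ (by positivity) (by positivity)]
  have h : η ^ 2 + 4 * (1 + η) * S ^ 2 ≤ 6 * (η + v) ^ 2 := by
    have : (1 + η) * S ^ 2 ≤ 6 * (v / 2) ^ 2 := by gcongr; linarith
    nlinarith [mul_pos hη hv]
  calc 1 / 3 * η * (η ^ 2 + 4 * (1 + η) * S ^ 2) ≤ 1 / 3 * η * (6 * (η + v) ^ 2) := by gcongr
    _ = η * 2 * (η + v) ^ 2 := by ring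
    _ ≤ _ := by gcongr; linarith

namespace IsEdgeDensity

variable {Θ M a c₁ C₁ : ℝ} {ρ : ℝ → ℝ}

lemma intervalIntegrable (h : IsEdgeDensity Θ M a c₁ C₁ ρ) :
    IntervalIntegrable ρ volume (-Real.pi) Real.pi :=
  intervalIntegral.intervalIntegrable_of_integral_ne_zero (by rw [h.2.1]; exact one_ne_zero)

lemma le_two_mul (h : IsEdgeDensity Θ M a c₁ C₁ ρ) (hΘ : 0 < Θ) (hc₁ : 0 < c₁) :
    a ≤ 2 * Θ := by
  by_contra! hlt
  obtain ⟨-, -, -, hsupp, -, hedge⟩ := h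
  have h1 := (hedge ((2 * Θ + a) / 2) (by linarith) (by linarith)).1
  rw [hsupp _ (by rw [lt_abs]; right; linarith)] at h1
  have : 0 < Real.sqrt ((2 * Θ + a) / 2) := Real.sqrt_pos.mpr (by linarith)
  nlinarith [mul_pos hc₁ this]

/-- The square-root upper bound extends to the whole half-line left of the edge. -/
lemma ae_le_sqrt (h : IsEdgeDensity Θ M a c₁ C₁ ρ) (ha : 0 < a) (hM : 0 < M) :
    ∀ᵐ x ∂(volume : Measure ℝ), x < Θ → ρ x ≤ max C₁ (M / Real.sqrt a) * Real.sqrt (Θ - x) := by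
  obtain ⟨-, -, -, -, hbd, hedge⟩ := h
  filter_upwards [hbd] with x hx hxΘ
  rcases lt_or_ge (Θ - x) a with hlt | hge
  · have h1 := (hedge (Θ - x) (by linarith) hlt).2
    rw [sub_sub_cancel] at h1
    refine h1.trans ?_
    gcongr
    exact le_max_left _ _
  · have hsa : 0 < Real.sqrt a := Real.sqrt_pos.mpr ha
    calc ρ x ≤ M := hx
      _ = M / Real.sqrt a * Real.sqrt a := by field_simp
      _ ≤ _ := by
        gcongr
        exact le_max_right _ _

lemma poissonIntegral_le (h : IsEdgeDensity Θ M a c₁ C₁ ρ) {δ η κ : ℝ} (hδ : 0 < δ)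
    (hδ' : δ < Real.pi) (hM : 0 < M) (ha : 0 < a) (hΘ : 0 < Θ)
    (hΘδ : Θ ≤ Real.pi - δ) (hη : 0 < η) (hη' : η ≤ 5) (hκ : 0 < κ) (hκ' : κ < Real.pi - Θ) :
    (∫ θ in (-Real.pi)..Real.pi,
        η * (2 + η) / (η ^ 2 + 4 * (1 + η) * Real.sin ((Θ + κ - θ) / 2) ^ 2) * ρ θ) ≤
      28 / (δ / Real.pi ^ 2) ^ 2 * max C₁ (M / Real.sqrt a) * η / Real.sqrt (κ + η) := by
  have hpi := Real.pi_pos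
  have hint := h.intervalIntegrable.continuousOn_mul
    (continuous_poissonKernel η (Θ + κ) hη).continuousOn
  have hae := h.ae_le_sqrt ha hM
  obtain ⟨hnn, -, -, hsupp, -, -⟩ := h
  set C' := max C₁ (M / Real.sqrt a) with hC'
  have hC'0 : 0 < C' := lt_max_of_lt_right (by positivity)
  set K := 14 / (δ / Real.pi ^ 2) ^ 2 with hK
  have hK0 : 0 < K := by positivity
  have hsub1 : Set.uIcc (-Real.pi) Θ ⊆ Set.uIcc (-Real.pi) Real.pi := by
    rw [Set.uIcc_of_le (by linarith), Set.uIcc_of_le (by linarith)]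
    exact Set.Icc_subset_Icc_right (by linarith)
  have hsub2 : Set.uIcc Θ Real.pi ⊆ Set.uIcc (-Real.pi) Real.pi := by
    rw [Set.uIcc_of_le (by linarith), Set.uIcc_of_le (by linarith)]
    exact Set.Icc_subset_Icc_left (by linarith)
  have hi1 := hint.mono_set hsub1
  rw [← intervalIntegral.integral_add_adjacent_intervals hi1 (hint.mono_set hsub2)]
  have hz : (∫ θ in Θ..Real.pi,
      η * (2 + η) / (η ^ 2 + 4 * (1 + η) * Real.sin ((Θ + κ - θ) / 2) ^ 2) * ρ θ) = 0 := by
    apply intervalIntegral.integral_zero_ae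
    refine Filter.Eventually.of_forall fun x hx => ?_
    rw [Set.uIoc_of_le (by linarith)] at hx
    rw [hsupp x (lt_of_lt_of_le hx.1 (le_abs_self x)), mul_zero]
  rw [hz, add_zero]
  have hA : Θ < Θ + κ + η := by linarith
  have hmono := intervalIntegral.integral_mono_ae_restrict
    (g := fun x => K * C' * η * (1 / ((Θ + κ + η - x) * Real.sqrt (Θ + κ + η - x))))
    (by linarith : -Real.pi ≤ Θ) hi1
    ((intervalIntegrable_one_div_mul_sqrt_sub (by linarith) hA).const_mul _) ?_
  · refine hmono.trans ?_
    rw [intervalIntegral.integral_const_mul]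
    calc _ ≤ K * C' * η * (2 / Real.sqrt (Θ + κ + η - Θ)) := by
          gcongr
          exact integral_one_div_mul_sqrt_sub_le (by linarith) hA
      _ = _ := by
          rw [show Θ + κ + η - Θ = κ + η by ring, hK]; ring
  · have hne : ∀ᵐ x ∂(volume : Measure ℝ), x ≠ Θ := by simp [ae_iff]
    refine (ae_restrict_iff' measurableSet_Icc).mpr ?_
    filter_upwards [hae, hne] with x hx hxne hxm
    have hxΘ : x < Θ := lt_of_le_of_ne hxm.2 hxne
    have hB : 0 < Θ + κ + η - x := by linarith
    have hsB := Real.sqrt_pos.mpr hB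
    rcases lt_or_ge x (-Θ) with hlt | hge
    · rw [hsupp x (by rw [lt_abs]; right; linarith), mul_zero]
      positivity
    · have h1 := poissonKernel_le (v := Θ + κ - x) hδ hδ' hη hη' (by linarith) (by linarith)
      have h2 : ρ x ≤ C' * Real.sqrt (Θ + κ + η - x) := by
        refine (hx hxΘ).trans (mul_le_mul_of_nonneg_left (Real.sqrt_le_sqrt ?_) hC'0.le)
        linarith
      calc _ ≤ K * η / (η + (Θ + κ - x)) ^ 2 * (C' * Real.sqrt (Θ + κ + η - x)) := by
            refine mul_le_mul h1 h2 (hnn x) ?_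
            positivity
        _ = _ := by
            rw [show η + (Θ + κ - x) = Θ + κ + η - x by ring]
            generalize Θ + κ + η - x = B at *
            field_simp
            rw [Real.sq_sqrt hB.le]

lemma le_poissonIntegral (h : IsEdgeDensity Θ M a c₁ C₁ ρ) {η κ : ℝ}
    (hc₁ : 0 < c₁) (ha : 0 < a) (hΘ : 0 < Θ)
    (hη : 0 < η) (hη' : η ≤ 5) (hκ : 0 < κ) (hκ' : κ < Real.pi - Θ) :
    c₁ / 3 * (a / 20 * Real.sqrt (a / 20)) / (1 + a / 10) ^ 2 * η / Real.sqrt (κ + η) ≤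
      ∫ θ in (-Real.pi)..Real.pi,
        η * (2 + η) / (η ^ 2 + 4 * (1 + η) * Real.sin ((Θ + κ - θ) / 2) ^ 2) * ρ θ := by
  have hpi := Real.pi_pos
  have hpi4 := Real.pi_le_four
  have hint := h.intervalIntegrable.continuousOn_mul
    (continuous_poissonKernel η (Θ + κ) hη).continuousOn
  have haΘ := h.le_two_mul hΘ hc₁
  obtain ⟨hnn, -, -, -, -, hedge⟩ := h
  obtain ⟨b, hb⟩ : ∃ b, b = a / 20 := ⟨_, rfl⟩
  obtain ⟨s, hs⟩ : ∃ s, s = κ + η := ⟨_, rfl⟩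
  have hb0 : 0 < b := by linarith
  have hs0 : 0 < s := by linarith
  have hbs : 0 < b * s := by positivity
  have hs9 : s ≤ 9 := by linarith
  have h2bs : 2 * (b * s) < a := by nlinarith
  have hle : Θ - 2 * (b * s) ≤ Θ - b * s := by linarith
  have hsub : Set.uIcc (Θ - 2 * (b * s)) (Θ - b * s) ⊆ Set.uIcc (-Real.pi) Real.pi := by
    rw [Set.uIcc_of_le hle, Set.uIcc_of_le (by linarith)]
    exact Set.Icc_subset_Icc (by linarith) (by linarith)
  have hrestr := intervalIntegral.integral_mono_interval (μ := volume)
    (c := -Real.pi) (a := Θ - 2 * (b * s)) (b := Θ - b * s) (d := Real.pi)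
    (by linarith) hle (by linarith)
    (Filter.Eventually.of_forall fun θ => ?_) hint
  · refine le_trans ?_ hrestr
    have hconst : ∀ θ ∈ Set.Icc (Θ - 2 * (b * s)) (Θ - b * s),
        1 / 3 * η / (s + 2 * (b * s)) ^ 2 * (c₁ * Real.sqrt (b * s)) ≤
        η * (2 + η) / (η ^ 2 + 4 * (1 + η) * Real.sin ((Θ + κ - θ) / 2) ^ 2) * ρ θ := by
      intro θ hθ
      have h1 := le_poissonKernel (v := Θ + κ - θ) hη hη' (by linarith [hθ.2])
      have h2 := (hedge (Θ - θ) (by linarith [hθ.2]) (by linarith [hθ.1])).1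
      rw [sub_sub_cancel] at h2
      refine mul_le_mul (le_trans ?_ h1) (le_trans ?_ h2) (by positivity) (by positivity)
      · have : 0 < η + (Θ + κ - θ) := by linarith [hθ.2]
        have : η + (Θ + κ - θ) ≤ s + 2 * (b * s) := by linarith [hθ.1]
        gcongr
      · gcongr
        linarith [hθ.2]
    have hmono := intervalIntegral.integral_mono_on hle intervalIntegrable_const
      (hint.mono_set hsub) hconst
    refine le_trans (le_of_eq ?_) hmono
    rw [intervalIntegral.integral_const, smul_eq_mul, ← hb, ← hs,
      show a / 10 = 2 * b by linarith, Real.sqrt_mul hb0.le]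
    have hss := Real.sqrt_pos.mpr hs0
    have hsq := Real.sq_sqrt hs0.le
    have hne : 1 + 2 * b ≠ 0 := by positivity
    rw [show s + 2 * (b * s) = s * (1 + 2 * b) by ring,
      show Θ - b * s - (Θ - 2 * (b * s)) = b * s by ring]
    field_simp
    rw [hsq]
  · have := hnn θ
    simp only [Pi.zero_apply]
    positivity

end IsEdgeDensity

/-- For a density with square-root edge behavior as above, there exist
constants `c, C > 0`, depending only on `δ₀, M, a, c₁, C₁`, such that for all `η ∈ (0, 5]`
and `κ ∈ (0, π − Θ)`, the point `z = (1+η)·e^{i(Θ+κ)}` satisfies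
`c·η/√(κ+η) ≤ −Re f_ρ(z) ≤ C·η/√(κ+η)`. -/
theorem stmt_11 (δ₀ M a c₁ C₁ : ℝ) (hδ₀ : 0 < δ₀) (hδ₀' : δ₀ < Real.pi) (hM : 0 < M)
    (ha : 0 < a) (hc₁ : 0 < c₁) (hc₁C₁ : c₁ ≤ C₁) :
    ∃ c C : ℝ, 0 < c ∧ 0 < C ∧
      ∀ Θ : ℝ, 0 < Θ → Θ ≤ Real.pi - δ₀ →
      ∀ ρ : ℝ → ℝ, IsEdgeDensity Θ M a c₁ C₁ ρ →
      ∀ η κ : ℝ, 0 < η → η ≤ 5 → 0 < κ → κ < Real.pi - Θ →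
        c * η / Real.sqrt (κ + η) ≤
            -(cauchyTransformD ρ
                (((1 + η : ℝ) : ℂ) * Complex.exp (((Θ + κ : ℝ) : ℂ) * Complex.I))).re ∧
          -(cauchyTransformD ρ
                (((1 + η : ℝ) : ℂ) * Complex.exp (((Θ + κ : ℝ) : ℂ) * Complex.I))).re ≤
            C * η / Real.sqrt (κ + η) := by
  have hpi := Real.pi_pos
  have hC : 0 < max C₁ (M / Real.sqrt a) := lt_max_of_lt_right (by positivity)
  refine ⟨c₁ / 3 * (a / 20 * Real.sqrt (a / 20)) / (1 + a / 10) ^ 2,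
    28 / (δ₀ / Real.pi ^ 2) ^ 2 * max C₁ (M / Real.sqrt a), by positivity, by positivity, ?_⟩
  intro Θ hΘ hΘδ ρ hρ η κ hη hη' hκ hκ'
  rw [neg_re_cauchyTransformD ρ hρ.intervalIntegrable η (Θ + κ) hη]
  exact ⟨hρ.le_poissonIntegral hc₁ ha hΘ hη hη' hκ hκ',
    hρ.poissonIntegral_le hδ₀ hδ₀' hM ha hΘ hΘδ hη hη' hκ hκ'⟩

end
end

section
/- Let 0 < Θ < π and let μ be a probability measure on the unit circle supported in the arc {e^{ix} : |x| ≤ Θ}. Then there exist absolute constants c, C > 0 such that for every η ∈ (0, 5] and every θ with Θ < |θ| ≤ π, writing κ := |θ| − Θ, the point z = (1+η)·e^{iθ} satisfies c·η ≤ −Re f_μ(z) ≤ C·η/κ². -/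
open MeasureTheory

noncomputable section

instance : MeasurableSpace Circle := borel Circle
instance : BorelSpace Circle := ⟨rfl⟩

/-- The Cauchy transform of a measure `μ` on the unit circle:
`f_μ(z) = ∫ (u + z)/(u − z) dμ(u)`. -/
def cauchyTransform (μ : Measure Circle) (z : ℂ) : ℂ :=
  ∫ u : Circle, ((u : ℂ) + z) / ((u : ℂ) - z) ∂μ

/-- The squared distance between a point of the unit circle and a point in polar form. -/
lemma normSq_circleExp_sub (x r θ : ℝ) :
    Complex.normSq ((Circle.exp x : ℂ) - (r : ℂ) * Complex.exp ((θ : ℂ) * Complex.I)) =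
      (r - 1) ^ 2 + 2 * r * (1 - Real.cos (θ - x)) := by
  rw [Circle.coe_exp, Complex.normSq_apply, Real.cos_sub]
  simp only [Complex.sub_re, Complex.sub_im, Complex.re_ofReal_mul, Complex.im_ofReal_mul,
    Complex.exp_ofReal_mul_I_re, Complex.exp_ofReal_mul_I_im]
  linear_combination Real.sin_sq_add_cos_sq x + r ^ 2 * Real.sin_sq_add_cos_sq θ

/-- The real part of the Cauchy kernel is the Poisson kernel up to sign. -/
lemma neg_re_add_div_sub (u z : ℂ) :
    -((u + z) / (u - z)).re =
      (Complex.normSq z - Complex.normSq u) / Complex.normSq (u - z) := by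
  rw [Complex.div_re, ← add_div, ← neg_div]
  congr 1
  simp only [Complex.normSq_apply, Complex.sub_re, Complex.sub_im, Complex.add_re, Complex.add_im]
  ring

/-- If `|x| ≤ Θ < |θ| ≤ π`, the points `e^{ix}` and `e^{iθ}` are separated quadratically in
`|θ| - Θ`. -/
lemma sq_le_one_sub_cos_sub {x Θ θ : ℝ} (hx : |x| ≤ Θ) (hΘ : Θ < |θ|) (hθ : |θ| ≤ Real.pi) :
    2 / Real.pi ^ 2 * (|θ| - Θ) ^ 2 ≤ 1 - Real.cos (θ - x) := by
  have hx0 := abs_nonneg x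
  have hle : |θ| - |x| ≤ |θ - x| := abs_sub_abs_le_abs_sub θ x
  have hadd : |θ - x| ≤ |θ| + |x| := abs_sub θ x
  have hκ : Real.cos (|θ| - Θ) ≤ 1 - 2 / Real.pi ^ 2 * (|θ| - Θ) ^ 2 :=
    Real.cos_le_one_sub_mul_cos_sq (abs_le.2 ⟨by linarith, by linarith⟩)
  have hcos : Real.cos (θ - x) ≤ Real.cos (|θ| - Θ) := by
    rw [← Real.cos_abs (θ - x)]
    rcases le_total |θ - x| Real.pi with h | h
    · exact Real.cos_le_cos_of_nonneg_of_le_pi (by linarith) h (by linarith)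
    · rw [← Real.cos_two_pi_sub |θ - x|]
      exact Real.cos_le_cos_of_nonneg_of_le_pi (by linarith) (by linarith) (by linarith)
  linarith

/-- Off the unit circle, the Cauchy kernel is integrable for every finite measure. -/
lemma integrable_cauchyKernel (μ : Measure Circle) [IsFiniteMeasure μ] {z : ℂ} (hz : ‖z‖ ≠ 1) :
    Integrable (fun u : Circle => ((u : ℂ) + z) / ((u : ℂ) - z)) μ := by
  refine Continuous.integrable_of_hasCompactSupport ?_ (HasCompactSupport.of_compactSpace _)
  refine Continuous.div (by fun_prop) (by fun_prop) fun u hu => hz ?_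
  rw [← sub_eq_zero.1 hu, Circle.norm_coe]

lemma neg_re_cauchyTransform (μ : Measure Circle) [IsFiniteMeasure μ] {z : ℂ} (hz : ‖z‖ ≠ 1) :
    -(cauchyTransform μ z).re = ∫ u : Circle, -(((u : ℂ) + z) / ((u : ℂ) - z)).re ∂μ := by
  rw [integral_neg, cauchyTransform]
  exact congrArg _ (Complex.reCLM.integral_comp_comm (integrable_cauchyKernel μ hz)).symm

/-- Bounds of a function almost everywhere pass to its mean. -/
lemma le_integral_and_integral_le {α : Type*} [MeasurableSpace α] {μ : Measure α}
    [IsProbabilityMeasure μ] {f : α → ℝ} (hf : Integrable f μ) {a b : ℝ}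
    (h : ∀ᵐ x ∂μ, a ≤ f x ∧ f x ≤ b) : a ≤ ∫ x, f x ∂μ ∧ ∫ x, f x ∂μ ≤ b := by
  constructor
  · simpa using integral_mono_ae (integrable_const a) hf (h.mono fun _ hx => hx.1)
  · simpa using integral_mono_ae hf (integrable_const b) (h.mono fun _ hx => hx.2)

/-- There exist absolute constants `c, C > 0` such that for every
`0 < Θ < π` and every probability measure `μ` on the unit circle supported in the arc
`{e^{ix} : |x| ≤ Θ}`, for every `η ∈ (0, 5]` and `θ` with `Θ < |θ| ≤ π`, writing
`κ = |θ| − Θ`, the point `z = (1+η)·e^{iθ}` satisfies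
`c·η ≤ −Re f_μ(z) ≤ C·η/κ²`. -/
theorem stmt_12 :
    ∃ c C : ℝ, 0 < c ∧ 0 < C ∧
      ∀ Θ : ℝ, 0 < Θ → Θ < Real.pi →
      ∀ μ : Measure Circle, IsProbabilityMeasure μ →
        μ ({u : Circle | ∃ x : ℝ, |x| ≤ Θ ∧ Circle.exp x = u}ᶜ) = 0 →
      ∀ η θ : ℝ, 0 < η → η ≤ 5 → Θ < |θ| → |θ| ≤ Real.pi →
        c * η ≤
            -(cauchyTransform μ
                (((1 + η : ℝ) : ℂ) * Complex.exp ((θ : ℂ) * Complex.I))).re ∧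
          -(cauchyTransform μ
                (((1 + η : ℝ) : ℂ) * Complex.exp ((θ : ℂ) * Complex.I))).re ≤
            C * η / (|θ| - Θ) ^ 2 := by
  refine ⟨2 / 49, 7 * Real.pi ^ 2 / 4, by norm_num, by positivity, ?_⟩
  intro Θ _ _ μ _ hsupp η θ hη hη5 hΘθ hθ
  set z : ℂ := ((1 + η : ℝ) : ℂ) * Complex.exp ((θ : ℂ) * Complex.I) with hz
  have hnorm : ‖z‖ = 1 + η := by
    rw [hz, norm_mul, Complex.norm_exp_ofReal_mul_I, mul_one,
      Complex.norm_of_nonneg (by linarith)]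
  have hz1 : ‖z‖ ≠ 1 := by rw [hnorm]; linarith
  rw [neg_re_cauchyTransform μ hz1]
  have hint : Integrable (fun u : Circle => -(((u : ℂ) + z) / ((u : ℂ) - z)).re) μ :=
    (integrable_cauchyKernel μ hz1).re.neg
  refine le_integral_and_integral_le hint ?_
  filter_upwards [show ∀ᵐ u ∂μ, ∃ x : ℝ, |x| ≤ Θ ∧ Circle.exp x = u from hsupp]
  rintro _ ⟨x, hx, rfl⟩
  rw [neg_re_add_div_sub, hz, normSq_circleExp_sub, ← hz, Complex.normSq_eq_norm_sq, hnorm,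
    Circle.normSq_coe]
  have hsep := sq_le_one_sub_cos_sub hx hΘθ hθ
  have hcos := Real.neg_one_le_cos (θ - x)
  have hκ : 0 < |θ| - Θ := sub_pos.2 hΘθ
  have hpos : 0 < 2 / Real.pi ^ 2 * (|θ| - Θ) ^ 2 := by positivity
  set t := 1 - Real.cos (θ - x)
  have ht : t ≤ 2 := by linarith
  have hden : 4 / Real.pi ^ 2 * (|θ| - Θ) ^ 2 ≤ (1 + η - 1) ^ 2 + 2 * (1 + η) * t := by
    have : 4 / Real.pi ^ 2 * (|θ| - Θ) ^ 2 = 2 * (2 / Real.pi ^ 2 * (|θ| - Θ) ^ 2) := by ring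
    nlinarith [mul_nonneg hη.le (hpos.le.trans hsep)]
  have hden' : (1 + η - 1) ^ 2 + 2 * (1 + η) * t ≤ 49 := by nlinarith
  have hden0 : 0 < 4 / Real.pi ^ 2 * (|θ| - Θ) ^ 2 := by positivity
  constructor
  · rw [le_div_iff₀ (hden0.trans_le hden)]
    nlinarith [mul_le_mul_of_nonneg_left hden' hη.le]
  · calc ((1 + η) ^ 2 - 1) / ((1 + η - 1) ^ 2 + 2 * (1 + η) * t)
        ≤ 7 * η / (4 / Real.pi ^ 2 * (|θ| - Θ) ^ 2) := by
          gcongr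
          nlinarith
      _ = 7 * Real.pi ^ 2 / 4 * η / (|θ| - Θ) ^ 2 := by
          have := Real.pi_ne_zero
          field_simp

end
end
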